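/- Let K be a field and let m be a positive integer. In the polynomial ring K[x,y] one has the containments (x, y^2)^{2m} ⊆ (x, y^4)^m ⊆ (x, y^2)^m, and the K-vector space (x, y^4)^m / (x, y^2)^{2m} has dimension exactly 2m^2. -/

import Mathlib

open MvPolynomial

/-- The ideal `(x, y⁴)^m` of `K[x,y]`. -/
noncomputable def idealA (K : Type*) [Field K] (m : ℕ) : Ideal (MvPolynomial (Fin 2) K) :=
  (Ideal.span {(X 0 : MvPolynomial (Fin 2) K), X 1 ^ 4}) ^ m

/-- The ideal `(x, y²)^{2m}` of `K[x,y]`. -/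
noncomputable def idealB (K : Type*) [Field K] (m : ℕ) : Ideal (MvPolynomial (Fin 2) K) :=
  (Ideal.span {(X 0 : MvPolynomial (Fin 2) K), X 1 ^ 2}) ^ (2 * m)

namespace PowSpanXY

variable {K : Type*} [Field K]

/-- The exponent of the monomial `x^i y^j`. -/
noncomputable def expo (i j : ℕ) : Fin 2 →₀ ℕ := Finsupp.single 0 i + Finsupp.single 1 j

@[simp] lemma expo_zero (i j : ℕ) : expo i j 0 = i := by simp [expo]

@[simp] lemma expo_one (i j : ℕ) : expo i j 1 = j := by simp [expo]

lemma expo_self (d : Fin 2 →₀ ℕ) : expo (d 0) (d 1) = d := by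
  ext k; fin_cases k <;> simp

/-- Polynomials all of whose monomials `x^i y^j` satisfy `n ≤ i + ⌊j / a⌋`. -/
def orderIdeal (K : Type*) [Field K] (a n : ℕ) : Ideal (MvPolynomial (Fin 2) K) where
  carrier := {f | ∀ d ∈ f.support, n ≤ d 0 + d 1 / a}
  zero_mem' := by simp
  add_mem' := by
    intro f g hf hg d hd
    rcases Finset.mem_union.1 (MvPolynomial.support_add hd) with h | h
    exacts [hf d h, hg d h]
  smul_mem' := by
    intro c f hf d hd
    obtain ⟨u, -, v, hv, rfl⟩ := Finset.mem_add.1 (MvPolynomial.support_mul c f hd)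
    have h₁ := hf v hv
    have h₂ : v 1 / a ≤ (u 1 + v 1) / a := Nat.div_le_div_right (Nat.le_add_left _ _)
    simp only [Finsupp.add_apply]
    omega

lemma orderIdeal_mul_le (a n k : ℕ) :
    orderIdeal K a n * orderIdeal K a k ≤ orderIdeal K a (n + k) := by
  refine Ideal.mul_le.2 fun f hf g hg d hd => ?_
  obtain ⟨u, hu, v, hv, rfl⟩ := Finset.mem_add.1 (MvPolynomial.support_mul f g hd)
  have h₁ := hf u hu
  have h₂ := hg v hv
  have h₃ : u 1 / a + v 1 / a ≤ (u 1 + v 1) / a := Nat.div_add_div_le_add_div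
  simp only [Finsupp.add_apply]
  omega

lemma span_le_orderIdeal {a : ℕ} (ha : 0 < a) :
    Ideal.span {(X 0 : MvPolynomial (Fin 2) K), X 1 ^ a} ≤ orderIdeal K a 1 := by
  rw [Ideal.span_le]
  rintro f (rfl | rfl) d hd
  · rw [support_X, Finset.mem_singleton] at hd
    simp [hd]
  · rw [support_X_pow, Finset.mem_singleton] at hd
    simp [hd, Nat.div_self ha]

lemma span_pow_eq_orderIdeal {a : ℕ} (ha : 0 < a) (n : ℕ) :
    Ideal.span {(X 0 : MvPolynomial (Fin 2) K), X 1 ^ a} ^ n = orderIdeal K a n := by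
  apply le_antisymm
  · induction n with
    | zero => intro f _ d _; exact Nat.zero_le _
    | succ n ih =>
      rw [pow_succ]
      exact (Ideal.mul_mono ih (span_le_orderIdeal ha)).trans (orderIdeal_mul_le a n 1)
  · intro f hf
    rw [f.as_sum]
    refine Ideal.sum_mem _ fun d hd => Ideal.pow_le_pow_right (hf d hd) ?_
    have hx : (X 0 : MvPolynomial (Fin 2) K) ∈
        Ideal.span {(X 0 : MvPolynomial (Fin 2) K), X 1 ^ a} := Ideal.subset_span (by simp)
    have hy : (X 1 ^ a : MvPolynomial (Fin 2) K) ∈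
        Ideal.span {(X 0 : MvPolynomial (Fin 2) K), X 1 ^ a} := Ideal.subset_span (by simp)
    have key : monomial d (coeff d f) = (C (coeff d f) * X 1 ^ (d 1 % a)) *
        ((X 0 : MvPolynomial (Fin 2) K) ^ d 0 * (X 1 ^ a) ^ (d 1 / a)) := by
      have h : (X 1 : MvPolynomial (Fin 2) K) ^ d 1 =
          X 1 ^ (d 1 % a) * (X 1 ^ a) ^ (d 1 / a) := by
        rw [← pow_mul, ← pow_add, Nat.mod_add_div]
      rw [monomial_eq, Finsupp.prod_fintype _ _ (by simp), Fin.prod_univ_two, h]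
      ring
    rw [key, pow_add]
    exact Ideal.mul_mem_left _ _
      (Ideal.mul_mem_mul (Ideal.pow_mem_pow hx _) (Ideal.pow_mem_pow hy _))

/-- The pairs `(i, j)` with `m ≤ i + ⌊j / 4⌋` and `i + ⌊j / 2⌋ < 2m`. -/
def gap (m : ℕ) : Finset (Σ _ : ℕ, ℕ) :=
  (Finset.range (2 * m)).sigma fun i => Finset.Ico (4 * (m - i)) (2 * (2 * m - i))

lemma mem_gap {m : ℕ} {p : Σ _ : ℕ, ℕ} :
    p ∈ gap m ↔ m ≤ p.1 + p.2 / 4 ∧ p.1 + p.2 / 2 < 2 * m := by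
  simp only [gap, Finset.mem_sigma, Finset.mem_range, Finset.mem_Ico]
  omega

lemma card_gap (m : ℕ) : (gap m).card = 2 * m ^ 2 := by
  simp only [gap, Finset.card_sigma, Nat.card_Ico]
  rw [two_mul m, Finset.sum_range_add, ← Finset.sum_add_distrib,
    Finset.sum_congr rfl (g := fun _ => 2 * m)]
  · simp only [Finset.sum_const, Finset.card_range, smul_eq_mul]
    ring
  · intro i hi
    have := Finset.mem_range.1 hi
    omega

/-- The coefficients of a polynomial at the exponents in `gap m`. -/
noncomputable def gapCoeff (K : Type*) [Field K] (m : ℕ) :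
    MvPolynomial (Fin 2) K →ₗ[K] (gap m → K) :=
  LinearMap.pi fun p => lcoeff K (expo p.1.1 p.1.2)

lemma gapCoeff_apply (m : ℕ) (f : MvPolynomial (Fin 2) K) (p : gap m) :
    gapCoeff K m f p = coeff (expo p.1.1 p.1.2) f := rfl

lemma exists_gapCoeff_eq (m : ℕ) (g : gap m → K) :
    ∃ f ∈ orderIdeal K 4 m, gapCoeff K m f = g := by
  classical
  refine ⟨∑ p, monomial (expo p.1.1 p.1.2) (g p), Ideal.sum_mem _ fun p _ d hd => ?_, ?_⟩
  · rw [Finset.mem_singleton.1 (support_monomial_subset hd)]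
    simpa using (mem_gap.1 p.2).1
  · ext q
    rw [gapCoeff_apply, coeff_sum, Finset.sum_eq_single q]
    · simp
    · intro p _ hpq
      rw [coeff_monomial, if_neg]
      intro h
      apply hpq
      have h₀ := DFunLike.congr_fun h 0
      have h₁ := DFunLike.congr_fun h 1
      simp only [expo_zero, expo_one] at h₀ h₁
      exact Subtype.ext (Sigma.ext h₀ (heq_of_eq h₁))
    · simp

lemma gapCoeff_eq_zero_iff {m : ℕ} {f : MvPolynomial (Fin 2) K} (hf : f ∈ orderIdeal K 4 m) :
    gapCoeff K m f = 0 ↔ f ∈ orderIdeal K 2 (2 * m) := by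
  constructor
  · intro h d hd
    by_contra! hlt
    have := congrFun h ⟨⟨d 0, d 1⟩, mem_gap.2 ⟨hf d hd, hlt⟩⟩
    rw [gapCoeff_apply, expo_self] at this
    exact mem_support_iff.1 hd this
  · intro h
    ext p
    rw [gapCoeff_apply, Pi.zero_apply]
    by_contra hne
    have h₁ := h _ (mem_support_iff.2 hne)
    have h₂ := (mem_gap.1 p.2).2
    rw [expo_zero, expo_one] at h₁
    omega

end PowSpanXY

open PowSpanXY in
/-- In `K[x,y]` one has `(x, y²)^{2m} ⊆ (x, y⁴)^m ⊆ (x, y²)^m`, and the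
`K`-vector space `(x, y⁴)^m / (x, y²)^{2m}` has dimension exactly `2m²`. -/
theorem dim_quotient_sandwich
    (K : Type*) [Field K] (m : ℕ) (hm : 1 ≤ m) :
    idealB K m ≤ idealA K m ∧
    idealA K m ≤ (Ideal.span {(X 0 : MvPolynomial (Fin 2) K), X 1 ^ 2}) ^ m ∧
    Module.finrank K
      (↥(Submodule.restrictScalars K (idealA K m)) ⧸
        (Submodule.comap (Submodule.restrictScalars K (idealA K m)).subtype
          (Submodule.restrictScalars K (idealB K m))))
      = 2 * m ^ 2 := by
  have hA : idealA K m = orderIdeal K 4 m := span_pow_eq_orderIdeal (by norm_num) m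
  have hB : idealB K m = orderIdeal K 2 (2 * m) := span_pow_eq_orderIdeal (by norm_num) (2 * m)
  rw [span_pow_eq_orderIdeal (by norm_num), hA, hB]
  refine ⟨fun f hf d hd => ?_, fun f hf d hd => ?_, ?_⟩
  · have := hf d hd
    omega
  · have := hf d hd
    omega
  · let φ := (gapCoeff K m).comp (Submodule.restrictScalars K (orderIdeal K 4 m)).subtype
    have hker : Submodule.comap (Submodule.restrictScalars K (orderIdeal K 4 m)).subtype
        (Submodule.restrictScalars K (orderIdeal K 2 (2 * m))) = LinearMap.ker φ := by
      ext f
      exact (gapCoeff_eq_zero_iff f.2).symm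
    have hsurj : Function.Surjective φ := fun g =>
      let ⟨f, hf, hg⟩ := exists_gapCoeff_eq m g
      ⟨⟨f, hf⟩, hg⟩
    rw [hker, (φ.quotKerEquivOfSurjective hsurj).finrank_eq, Module.finrank_fintype_fun_eq_card,
      Fintype.card_coe, card_gap]
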